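/- Let a and b be real numbers with 0 < a ≤ 1 ≤ b. Then there is a constant C = C(a,b) such that for every integer n ≥ 2, | S_{a,b}(n) − [Γ(a+1)Γ(b+1)/Γ(a+b+2)]·[ζ(a+1)ζ(b+1)/ζ(a+b+2)]·σ_{a+b+1}(n) | ≤ C·n^{b+1}·(log n)². -/

import Mathlib

open Finset

/-- `σ_a(n) = ∑_{d ∣ n} d^a` for real `a`. -/
noncomputable def sigmaR (a : ℝ) (n : ℕ) : ℝ := ∑ d ∈ n.divisors, (d : ℝ) ^ a

/-- `S_{a,b}(n) = ∑_{k=1}^{n-1} σ_a(k) σ_b(n-k)`. -/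
noncomputable def SR (a b : ℝ) (n : ℕ) : ℝ :=
  ∑ k ∈ Finset.Ico 1 n, sigmaR a k * sigmaR b (n - k)

/-- The Riemann zeta function at a real argument (it takes real values there). -/
noncomputable def zetaR (x : ℝ) : ℝ := (riemannZeta (x : ℂ)).re

lemma mono_sum_int (G : ℝ → ℝ) (hG : Monotone G) (x : ℝ) (m : ℕ) :
    |∑ i ∈ range m, G (x + i) - ∫ t in x..x + m, G t| ≤ G (x + m) - G x := by
  have h1 := MonotoneOn.sum_le_integral (f := G) (x₀ := x) (a := m) (hG.monotoneOn _)
  have h2 := MonotoneOn.integral_le_sum (f := G) (x₀ := x) (a := m) (hG.monotoneOn _)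
  have h3 : ∑ i ∈ range m, G (x + ↑(i + 1)) - ∑ i ∈ range m, G (x + i) = G (x + m) - G x := by
    rw [← Finset.sum_sub_distrib, Finset.sum_range_sub (fun i : ℕ => G (x + i))]
    simp
  rw [abs_le]
  have := hG (show x ≤ x + m by simp)
  constructor <;> linarith

lemma unimodal_sum_int (G : ℝ → ℝ) (c M : ℝ) (h1 : MonotoneOn G (Set.Iic c))
    (h2 : AntitoneOn G (Set.Ici c)) (h0 : ∀ x, 0 ≤ G x) (hM : ∀ x, G x ≤ M) (x : ℝ) (m : ℕ) :
    |∑ i ∈ range m, G (x + i) - ∫ t in x..x + m, G t| ≤ 2 * M := by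
  have m1 : Monotone (fun t => G (min t c)) := fun s t hst =>
    h1 (by simp) (by simp) (min_le_min_right c hst)
  have m2 : Monotone (fun t => - G (max t c)) := fun s t hst =>
    neg_le_neg (h2 (by simp) (by simp) (max_le_max_right c hst))
  have e : ∀ t, G t = G (min t c) - (- G (max t c)) - G c := by
    intro t
    rcases le_total t c with h | h <;> simp [h]
  have b1 := mono_sum_int _ m1 x m
  have b2 := mono_sum_int _ m2 x m
  have i1 : IntervalIntegrable (fun t => G (min t c)) MeasureTheory.volume x (x + m) :=
    m1.intervalIntegrable
  have i2 : IntervalIntegrable (fun t => - G (max t c)) MeasureTheory.volume x (x + m) :=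
    m2.intervalIntegrable
  have eI : ∫ t in x..x + m, G t = (∫ t in x..x + m, G (min t c))
      - (∫ t in x..x + m, - G (max t c)) - m * G c := by
    rw [← intervalIntegral.integral_sub i1 i2]
    have : (m : ℝ) * G c = ∫ t in x..x + m, G c := by simp
    rw [this, ← intervalIntegral.integral_sub (i1.sub i2) (by simp)]
    exact intervalIntegral.integral_congr (fun t _ => e t)
  have eS : ∑ i ∈ range m, G (x + i) = ∑ i ∈ range m, G (min (x + i) c)
      - ∑ i ∈ range m, (- G (max (x + i) c)) - m * G c := by
    have : (m : ℝ) * G c = ∑ i ∈ range m, G c := by simp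
    rw [this, ← Finset.sum_sub_distrib, ← Finset.sum_sub_distrib]
    exact Finset.sum_congr rfl (fun t _ => e _)
  rw [eI, eS]
  have p1 := h0 (min x c)
  have p2 := hM (min (x + m) c)
  have p3 := h0 (max (x + m) c)
  have p4 := hM (max x c)
  rw [abs_le] at *
  constructor <;> linarith

/-- the weight function, extended by zero -/
noncomputable def ff (a b N x : ℝ) : ℝ := (max x 0) ^ a * (max (N - x) 0) ^ b

lemma ff_nonneg (a b N x : ℝ) : 0 ≤ ff a b N x := by unfold ff; positivity

lemma ff_zero_left {a b N x : ℝ} (ha : 0 < a) (h : x ≤ 0) : ff a b N x = 0 := by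
  unfold ff; rw [max_eq_right h, Real.zero_rpow ha.ne', zero_mul]

lemma ff_zero_right {a b N x : ℝ} (hb : 0 < b) (h : N ≤ x) : ff a b N x = 0 := by
  unfold ff; rw [max_eq_right (show N - x ≤ 0 by linarith), Real.zero_rpow hb.ne', mul_zero]

lemma ff_mid {a b N x : ℝ} (h : 0 ≤ x) (h' : x ≤ N) : ff a b N x = x ^ a * (N - x) ^ b := by
  unfold ff; rw [max_eq_left h, max_eq_left (by linarith)]

lemma ff_cont {a b N : ℝ} (ha : 0 < a) (hb : 0 < b) : Continuous (ff a b N) := by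
  unfold ff
  apply Continuous.mul
  · exact (by fun_prop : Continuous fun x : ℝ => max x 0).rpow_const (fun _ => Or.inr ha.le)
  · exact (by fun_prop : Continuous fun x : ℝ => max (N - x) 0).rpow_const (fun _ => Or.inr hb.le)

lemma ff_le {a b N : ℝ} (ha : 0 < a) (hb : 0 < b) (hN : 0 < N) (x : ℝ) :
    ff a b N x ≤ N ^ (a + b) := by
  rcases le_total x 0 with h | h
  · rw [ff_zero_left ha h]; positivity
  rcases le_total N x with h' | h'
  · rw [ff_zero_right hb h']; positivity
  rw [ff_mid h h', Real.rpow_add hN]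
  have : 0 ≤ N - x := by linarith
  gcongr
  linarith

lemma ff_comp {a b N x y : ℝ} (ha : 0 < a) (hb : 0 < b) (hy : 0 < y) (hy' : y < N)
    (h : (y - x) * (b * y - a * (N - y)) ≤ 0) : ff a b N x ≤ ff a b N y := by
  rcases le_total x 0 with h1 | h1
  · rw [ff_zero_left ha h1]; exact ff_nonneg _ _ _ _
  rcases le_total N x with h2 | h2
  · rw [ff_zero_right hb h2]; exact ff_nonneg _ _ _ _
  rw [ff_mid h1 h2, ff_mid hy.le hy'.le]
  have hNy : 0 < N - y := by linarith
  have hNx : 0 ≤ N - x := by linarith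
  have key : ∀ u c : ℝ, 0 ≤ u → 0 < c → u ^ c ≤ Real.exp (c * (u - 1)) := by
    intro u c hu hc
    have : u ≤ Real.exp (u - 1) := by have := Real.add_one_le_exp (u - 1); linarith
    calc u ^ c ≤ (Real.exp (u - 1)) ^ c := by gcongr
      _ = _ := by rw [← Real.exp_mul, mul_comm]
  have k1 := key (x / y) a (by positivity) ha
  have k2 := key ((N - x) / (N - y)) b (by positivity) hb
  have : (x / y) ^ a * ((N - x) / (N - y)) ^ b ≤ 1 := by
    calc _ ≤ Real.exp (a * (x / y - 1)) * Real.exp (b * ((N - x) / (N - y) - 1)) := by gcongr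
      _ = Real.exp (a * (x / y - 1) + b * ((N - x) / (N - y) - 1)) := by rw [Real.exp_add]
      _ ≤ 1 := by
        rw [Real.exp_le_one_iff]
        have : a * (x / y - 1) + b * ((N - x) / (N - y) - 1)
          = ((y - x) * (b * y - a * (N - y))) / (y * (N - y)) := by
          field_simp; ring
        rw [this]
        exact div_nonpos_of_nonpos_of_nonneg h (by positivity)
  rw [Real.div_rpow h1 hy.le, Real.div_rpow hNx hNy.le, div_mul_div_comm,
    div_le_one (by positivity)] at this
  exact this

lemma ff_mono {a b N : ℝ} (ha : 0 < a) (hb : 0 < b) (_hN : 0 < N) :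
    MonotoneOn (ff a b N) (Set.Iic (a * N / (a + b))) := by
  intro x hx y hy hxy
  rcases le_or_gt y 0 with h | h
  · rw [ff_zero_left ha h, ff_zero_left ha (hxy.trans h)]
  have hy' : y * (a + b) ≤ a * N := by rw [← le_div_iff₀ (by positivity)]; exact hy
  apply ff_comp ha hb h
  · by_contra hc
    push Not at hc
    nlinarith
  · apply mul_nonpos_of_nonneg_of_nonpos <;> linarith

lemma ff_anti {a b N : ℝ} (ha : 0 < a) (hb : 0 < b) (hN : 0 < N) :
    AntitoneOn (ff a b N) (Set.Ici (a * N / (a + b))) := by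
  intro y hy x hx hxy
  rcases le_or_gt N y with h | h
  · rw [ff_zero_right hb h, ff_zero_right hb (h.trans hxy)]
  have hy' : a * N ≤ y * (a + b) := by rw [← div_le_iff₀ (by positivity)]; exact hy
  apply ff_comp ha hb _ h
  · apply mul_nonpos_of_nonpos_of_nonneg <;> linarith
  · by_contra hc
    have : 0 < a * N := by positivity
    nlinarith

lemma ff_integral {a b N : ℝ} (ha : 0 < a) (hb : 0 < b) (hN : 0 < N) :
    ∫ x in (0:ℝ)..N, ff a b N x = N ^ (a + b + 1) *
      (Real.Gamma (a + 1) * Real.Gamma (b + 1) / Real.Gamma (a + b + 2)) := by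
  have h := Complex.betaIntegral_scaled ((a + 1 : ℝ) : ℂ) ((b + 1 : ℝ) : ℂ) hN
  have hB := Complex.betaIntegral_eq_Gamma_mul_div ((a + 1 : ℝ) : ℂ) ((b + 1 : ℝ) : ℂ)
    (by rw [Complex.ofReal_re]; linarith) (by rw [Complex.ofReal_re]; linarith)
  rw [hB, ← Complex.ofReal_add, Complex.Gamma_ofReal, Complex.Gamma_ofReal,
    Complex.Gamma_ofReal] at h
  have e : ∫ x in (0:ℝ)..N, (x:ℂ) ^ (((a + 1 : ℝ) : ℂ) - 1) * ((N:ℂ) - x) ^ (((b + 1 : ℝ) : ℂ) - 1)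
      = ((∫ x in (0:ℝ)..N, ff a b N x : ℝ) : ℂ) := by
    rw [← intervalIntegral.integral_ofReal]
    apply intervalIntegral.integral_congr
    intro x hx
    rw [Set.uIcc_of_le hN.le] at hx
    simp only
    rw [ff_mid hx.1 hx.2, Complex.ofReal_mul, Complex.ofReal_cpow hx.1,
      Complex.ofReal_cpow (by linarith [hx.2])]
    push_cast
    simp
  rw [e] at h
  have e2 : ((a + 1 + (b + 1) : ℝ) : ℂ) - 1 = ((a + b + 1 : ℝ) : ℂ) := by push_cast; ring
  rw [e2, ← Complex.ofReal_cpow hN.le] at h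
  have e3 : a + 1 + (b + 1) = a + b + 2 := by ring
  rw [e3] at h
  exact_mod_cast h

lemma ap_sum {a b : ℝ} (ha : 0 < a) (hb : 0 < b) (n r L : ℕ) (hn : 0 < n) (hL : 0 < L)
    (hr : r < L) :
    |∑ j ∈ range n, ff a b n ((r : ℝ) + j * L) - (n : ℝ) ^ (a + b + 1) *
      (Real.Gamma (a + 1) * Real.Gamma (b + 1) / Real.Gamma (a + b + 2)) / L|
      ≤ 3 * (n : ℝ) ^ (a + b) := by
  have hn' : (0:ℝ) < n := by exact_mod_cast hn
  have hL' : (0:ℝ) < L := by exact_mod_cast hL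
  have hL1 : (1:ℝ) ≤ L := by exact_mod_cast hL
  set G : ℝ → ℝ := fun t => ff a b n (t * L) with hG
  set c : ℝ := a * n / (a + b) with hc
  have hcont : Continuous G := (ff_cont ha hb).comp (by fun_prop)
  have h1 : MonotoneOn G (Set.Iic (c / L)) := by
    intro x hx y hy hxy
    exact ff_mono ha hb hn' ((le_div_iff₀ hL').1 hx) ((le_div_iff₀ hL').1 hy) (by gcongr)
  have h2 : AntitoneOn G (Set.Ici (c / L)) := by
    intro x hx y hy hxy
    exact ff_anti ha hb hn' ((div_le_iff₀ hL').1 hx) ((div_le_iff₀ hL').1 hy) (by gcongr)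
  have key := unimodal_sum_int G (c / L) _ h1 h2 (fun x => ff_nonneg _ _ _ _)
    (fun x => ff_le ha hb hn' _) ((r : ℝ) / L) n
  have eS : ∑ i ∈ range n, G ((r : ℝ) / L + i) = ∑ j ∈ range n, ff a b n ((r : ℝ) + j * L) := by
    apply Finset.sum_congr rfl
    intro i _
    simp only [hG]
    congr 1
    field_simp
  have hx0 : 0 ≤ (r : ℝ) / L := by positivity
  have hx1 : (r : ℝ) / L ≤ 1 := by rw [div_le_one hL']; exact_mod_cast hr.le
  have ii : ∀ u v : ℝ, IntervalIntegrable G MeasureTheory.volume u v :=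
    fun u v => hcont.intervalIntegrable u v
  have eI : (∫ t in (0:ℝ)..(r : ℝ) / L, G t) + (∫ t in ((r : ℝ) / L)..((r : ℝ) / L + n), G t)
      = (∫ t in (0:ℝ)..(n : ℝ) / L, G t) + ∫ t in ((n : ℝ) / L)..((r : ℝ) / L + n), G t := by
    rw [intervalIntegral.integral_add_adjacent_intervals (ii _ _) (ii _ _),
      intervalIntegral.integral_add_adjacent_intervals (ii _ _) (ii _ _)]
  have e0 : ∫ t in ((n : ℝ) / L)..((r : ℝ) / L + n), G t = 0 := by
    have hle : (n : ℝ) / L ≤ (r : ℝ) / L + n := by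
      have : (n : ℝ) / L ≤ n := div_le_self hn'.le hL1
      linarith
    rw [intervalIntegral.integral_congr (g := fun _ => (0:ℝ))]
    · simp
    · intro t ht
      rw [Set.uIcc_of_le hle] at ht
      exact ff_zero_right hb ((div_le_iff₀ hL').1 ht.1)
  have e1 : ∫ t in (0:ℝ)..(n : ℝ) / L, G t = (n : ℝ) ^ (a + b + 1) *
      (Real.Gamma (a + 1) * Real.Gamma (b + 1) / Real.Gamma (a + b + 2)) / L := by
    rw [← ff_integral ha hb hn']
    simp only [hG]
    rw [intervalIntegral.integral_comp_mul_right _ hL'.ne']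
    rw [zero_mul, div_mul_cancel₀ _ hL'.ne', smul_eq_mul]
    ring
  have e2 : |∫ t in (0:ℝ)..(r : ℝ) / L, G t| ≤ (n : ℝ) ^ (a + b) := by
    have := intervalIntegral.norm_integral_le_of_norm_le_const (f := G) (a := 0) (b := (r : ℝ) / L)
      (C := (n : ℝ) ^ (a + b)) (fun x _ => by
        rw [Real.norm_eq_abs, abs_of_nonneg (ff_nonneg _ _ _ _)]
        exact ff_le ha hb hn' _)
    rw [sub_zero, abs_of_nonneg hx0, Real.norm_eq_abs] at this
    refine this.trans ?_
    apply mul_le_of_le_one_right (by positivity) hx1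
  rw [eS] at key
  rw [← e1]
  rw [abs_le] at *
  constructor <;> linarith

/-- `g` if `g ∣ n`, zero otherwise. -/
noncomputable def ww (n g : ℕ) : ℝ := if g ∣ n then (g : ℝ) else 0

/-- inner sum -/
noncomputable def TT (a b : ℝ) (n d e : ℕ) : ℝ :=
  ∑ k ∈ Ico 1 n, if d ∣ k ∧ e ∣ n - k then ff a b n k else 0

lemma TT_eq_ap {a b : ℝ} (ha : 0 < a) (hb : 0 < b) (n r d e : ℕ)
    (hd : 0 < d) (he : 0 < e) (hr : r < Nat.lcm d e) (h1 : r ≡ 0 [MOD d]) (h2 : r ≡ n [MOD e]) :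
    TT a b n d e = ∑ j ∈ range n, ff a b n ((r : ℝ) + j * (Nat.lcm d e : ℕ)) := by
  have hL : 0 < Nat.lcm d e := Nat.lcm_pos hd he
  set L := Nat.lcm d e with hLdef
  have hdL : d ∣ L := Nat.dvd_lcm_left d e
  have heL : e ∣ L := Nat.dvd_lcm_right d e
  unfold TT
  rw [← Finset.sum_filter]
  have : ∑ j ∈ range n, ff a b n ((r : ℝ) + j * (L : ℕ)) =
      ∑ j ∈ (range n).filter (fun j => 1 ≤ r + j * L ∧ r + j * L < n),
        ff a b n ((r : ℝ) + j * (L : ℕ)) := by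
    rw [Finset.sum_filter]
    apply Finset.sum_congr rfl
    intro j _
    split_ifs with h
    · rfl
    · rw [not_and_or] at h
      rcases h with h | h
      · apply ff_zero_left ha
        have : r + j * L = 0 := by omega
        have h' : (r : ℝ) + j * L = 0 := by exact_mod_cast this
        exact h'.le
      · apply ff_zero_right hb
        have : n ≤ r + j * L := by omega
        exact_mod_cast this
  rw [this]
  apply Finset.sum_nbij' (fun k => k / L) (fun j => r + j * L)
  · intro k hk
    simp only [mem_filter, mem_Ico, mem_range] at hk ⊢
    obtain ⟨⟨hk1, hk2⟩, hdk, hek⟩ := hk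
    have m1 : k ≡ r [MOD d] := ((Nat.modEq_zero_iff_dvd).2 hdk).trans h1.symm
    have m2 : k ≡ r [MOD e] := ((Nat.modEq_iff_dvd' hk2.le).2 hek).trans h2.symm
    have m3 : k ≡ r [MOD L] := Nat.mod_lcm m1 m2
    have m4 : k % L = r := by rw [m3, Nat.mod_eq_of_lt hr]
    have m5 : r + k / L * L = k := by rw [← m4, mul_comm]; exact Nat.mod_add_div k L
    refine ⟨lt_of_le_of_lt (Nat.div_le_self _ _) hk2, ?_, ?_⟩ <;> rw [m5] <;> assumption
  · intro j hj
    simp only [mem_filter, mem_Ico, mem_range] at hj ⊢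
    refine ⟨hj.2, ?_, ?_⟩
    · exact dvd_add ((Nat.modEq_zero_iff_dvd).1 h1) (dvd_mul_of_dvd_right hdL _)
    · rw [← Nat.modEq_iff_dvd' hj.2.2.le]
      have : j * L ≡ 0 [MOD e] := (Nat.modEq_zero_iff_dvd).2 (dvd_mul_of_dvd_right heL _)
      simpa using h2.add this
  · intro k hk
    simp only [mem_filter, mem_Ico, mem_range] at hk ⊢
    obtain ⟨⟨hk1, hk2⟩, hdk, hek⟩ := hk
    have m1 : k ≡ r [MOD d] := ((Nat.modEq_zero_iff_dvd).2 hdk).trans h1.symm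
    have m2 : k ≡ r [MOD e] := ((Nat.modEq_iff_dvd' hk2.le).2 hek).trans h2.symm
    have m3 : k ≡ r [MOD L] := Nat.mod_lcm m1 m2
    have m4 : k % L = r := by rw [m3, Nat.mod_eq_of_lt hr]
    rw [← m4, mul_comm]; exact Nat.mod_add_div k L
  · intro j hj
    rw [Nat.add_mul_div_right _ _ hL, Nat.div_eq_of_lt hr, zero_add]
  · intro k hk
    simp only [mem_filter, mem_Ico, mem_range] at hk
    obtain ⟨⟨hk1, hk2⟩, hdk, hek⟩ := hk
    have m1 : k ≡ r [MOD d] := ((Nat.modEq_zero_iff_dvd).2 hdk).trans h1.symm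
    have m2 : k ≡ r [MOD e] := ((Nat.modEq_iff_dvd' hk2.le).2 hek).trans h2.symm
    have m3 : k ≡ r [MOD L] := Nat.mod_lcm m1 m2
    have m4 : k % L = r := by rw [m3, Nat.mod_eq_of_lt hr]
    have m5 : r + k / L * L = k := by rw [← m4, mul_comm]; exact Nat.mod_add_div k L
    congr 1
    exact_mod_cast m5.symm

lemma TT_bound {a b : ℝ} (ha : 0 < a) (hb : 0 < b) (n d e : ℕ) (hn : 0 < n)
    (hd : 0 < d) (he : 0 < e) :
    |TT a b n d e - (n : ℝ) ^ (a + b + 1) *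
      (Real.Gamma (a + 1) * Real.Gamma (b + 1) / Real.Gamma (a + b + 2)) *
        (ww n (Nat.gcd d e) / (d * e))| ≤ 3 * (n : ℝ) ^ (a + b) := by
  have hd' : (0:ℝ) < d := by exact_mod_cast hd
  have he' : (0:ℝ) < e := by exact_mod_cast he
  by_cases hg : Nat.gcd d e ∣ n
  · have hm : 0 ≡ n [MOD Nat.gcd d e] := ((Nat.modEq_zero_iff_dvd).2 hg).symm
    have hr := Nat.chineseRemainder'_lt_lcm hm hd.ne' he.ne'
    obtain ⟨h1, h2⟩ := (Nat.chineseRemainder' hm).2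
    rw [TT_eq_ap ha hb n _ d e hd he hr h1 h2]
    have hL : 0 < Nat.lcm d e := Nat.lcm_pos hd he
    have := ap_sum ha hb n _ _ hn hL hr
    have e1 : ww n (Nat.gcd d e) / (d * e) = 1 / (Nat.lcm d e : ℕ) := by
      unfold ww
      rw [if_pos hg]
      have : (Nat.gcd d e : ℝ) * (Nat.lcm d e : ℕ) = d * e := by
        exact_mod_cast Nat.gcd_mul_lcm d e
      have hL' : (0:ℝ) < (Nat.lcm d e : ℕ) := by exact_mod_cast hL
      rw [div_eq_div_iff (by positivity) hL'.ne']
      linarith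
    rw [e1, mul_one_div]
    exact this
  · have : TT a b n d e = 0 := by
      unfold TT
      apply Finset.sum_eq_zero
      intro k hk
      rw [mem_Ico] at hk
      rw [if_neg]
      rintro ⟨h1, h2⟩
      apply hg
      have h3 : Nat.gcd d e ∣ k := (Nat.gcd_dvd_left d e).trans h1
      have h4 : Nat.gcd d e ∣ n - k := (Nat.gcd_dvd_right d e).trans h2
      have := dvd_add h4 h3
      rwa [Nat.sub_add_cancel hk.2.le] at this
    rw [this, ww, if_neg hg]
    simp
    positivity

lemma sigma_eq (a : ℝ) (n k : ℕ) (hk : 0 < k) (hkn : k < n) :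
    sigmaR a k = ∑ d ∈ Ico 1 n, if d ∣ k then (d : ℝ) ^ (-a) * (k : ℝ) ^ a else 0 := by
  unfold sigmaR
  rw [← Nat.sum_div_divisors k (fun d => (d : ℝ) ^ a), ← Finset.sum_filter]
  have : k.divisors = (Ico 1 n).filter (fun d => d ∣ k) := by
    ext d
    simp only [Nat.mem_divisors, mem_filter, mem_Ico]
    constructor
    · rintro ⟨h, _⟩
      exact ⟨⟨Nat.pos_of_dvd_of_pos h hk, lt_of_le_of_lt (Nat.le_of_dvd hk h) hkn⟩, h⟩
    · rintro ⟨_, h⟩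
      exact ⟨h, hk.ne'⟩
  rw [this]
  apply Finset.sum_congr rfl
  intro d hd
  simp only [mem_filter, mem_Ico] at hd
  have hd' : (0:ℝ) < d := by exact_mod_cast hd.1.1
  rw [Nat.cast_div hd.2 hd'.ne', Real.div_rpow (by positivity) hd'.le, Real.rpow_neg hd'.le]
  field_simp

lemma SR_eq (a b : ℝ) (n : ℕ) :
    SR a b n = ∑ d ∈ Ico 1 n, ∑ e ∈ Ico 1 n, (d : ℝ) ^ (-a) * (e : ℝ) ^ (-b) * TT a b n d e := by
  unfold SR TT
  have : ∀ k ∈ Ico 1 n, sigmaR a k * sigmaR b (n - k) = ∑ d ∈ Ico 1 n, ∑ e ∈ Ico 1 n,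
      (d : ℝ) ^ (-a) * (e : ℝ) ^ (-b) * (if d ∣ k ∧ e ∣ n - k then ff a b n k else 0) := by
    intro k hk
    rw [mem_Ico] at hk
    rw [sigma_eq a n k (by omega) hk.2, sigma_eq b n (n - k) (by omega) (by omega),
      Finset.sum_mul_sum]
    apply Finset.sum_congr rfl
    intro d _
    apply Finset.sum_congr rfl
    intro e _
    have hkn : (k : ℝ) ≤ n := by exact_mod_cast hk.2.le
    rw [ff_mid (by positivity) hkn, Nat.cast_sub hk.2.le]
    by_cases h1 : d ∣ k <;> by_cases h2 : e ∣ n - k <;> simp [h1, h2]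
    ring
  rw [Finset.sum_congr rfl this, Finset.sum_comm]
  apply Finset.sum_congr rfl
  intro d _
  rw [Finset.sum_comm]
  apply Finset.sum_congr rfl
  intro e _
  rw [Finset.mul_sum]

lemma zp_summable {s : ℝ} (hs : 1 < s) : Summable (fun n : ℕ => (n : ℝ) ^ (-s)) :=
  Real.summable_nat_rpow.2 (by linarith)

lemma zetaR_eq {s : ℝ} (hs : 1 < s) : zetaR s = ∑' n : ℕ, (n : ℝ) ^ (-s) := by
  unfold zetaR
  rw [zeta_eq_tsum_one_div_nat_cpow (by simpa using hs)]
  have : ∀ n : ℕ, 1 / (n : ℂ) ^ (s : ℂ) = (((n : ℝ) ^ (-s) : ℝ) : ℂ) := by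
    intro n
    rw [Real.rpow_neg (by positivity), Complex.ofReal_inv, Complex.ofReal_cpow (by positivity)]
    simp
  rw [tsum_congr this, ← Complex.ofReal_tsum, Complex.ofReal_re]

lemma zetaR_pos {s : ℝ} (hs : 1 < s) : 0 < zetaR s := by
  rw [zetaR_eq hs]
  exact (zp_summable hs).tsum_pos (fun n => by positivity) 1 (by simp)

/-- sum over coprime pairs -/
noncomputable def PP (s t : ℝ) : ℝ :=
  ∑' p : ℕ × ℕ, if Nat.Coprime p.1 p.2 then (p.1 : ℝ) ^ (-s) * (p.2 : ℝ) ^ (-t) else 0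

lemma pair_summable {s t : ℝ} (hs : 1 < s) (ht : 1 < t) :
    Summable (fun p : ℕ × ℕ => (p.1 : ℝ) ^ (-s) * (p.2 : ℝ) ^ (-t)) :=
  (zp_summable hs).mul_of_nonneg (zp_summable ht) (fun n => by positivity) (fun n => by positivity)

lemma cop_summable {s t : ℝ} (hs : 1 < s) (ht : 1 < t) :
    Summable (fun p : ℕ × ℕ =>
      if Nat.Coprime p.1 p.2 then (p.1 : ℝ) ^ (-s) * (p.2 : ℝ) ^ (-t) else 0) := by
  apply Summable.of_nonneg_of_le _ _ (pair_summable hs ht)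
  · intro p; split_ifs <;> positivity
  · intro p; split_ifs
    · exact le_rfl
    · positivity

lemma pair_identity {s t : ℝ} (hs : 1 < s) (ht : 1 < t) (w : ℕ → ℝ) (K : ℝ)
    (w0 : ∀ g, 0 ≤ w g) (wK : ∀ g, w g ≤ K) :
    ∑' p : ℕ × ℕ, w (Nat.gcd p.1 p.2) * ((p.1 : ℝ) ^ (-s) * (p.2 : ℝ) ^ (-t)) =
      (∑' g : ℕ, w g * (g : ℝ) ^ (-(s + t))) * PP s t := by
  have hw : Summable (fun g : ℕ => w g * (g : ℝ) ^ (-(s + t))) := by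
    apply Summable.of_nonneg_of_le _ _ ((zp_summable (s := s + t) (by linarith)).mul_left K)
    · intro g; have := w0 g; positivity
    · intro g; have := wK g; gcongr
  unfold PP
  rw [hw.tsum_mul_tsum (cop_summable hs ht) (hw.mul_of_nonneg (cop_summable hs ht)
    (fun g => by have := w0 g; simp only [Pi.zero_apply]; positivity)
    (fun p => by simp only [Pi.zero_apply]; split_ifs <;> positivity))]
  have pos_of : ∀ (x : ℕ) (r : ℝ), 1 < r → (x : ℝ) ^ (-r) ≠ 0 → 0 < x := by
    intro x r hr h
    rcases Nat.eq_zero_or_pos x with h' | h'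
    · exfalso; apply h; rw [h', Nat.cast_zero, Real.zero_rpow (by linarith)]
    · exact h'
  have supp : ∀ z : ℕ × (ℕ × ℕ), w z.1 * (z.1 : ℝ) ^ (-(s + t)) *
      (if Nat.Coprime z.2.1 z.2.2 then (z.2.1 : ℝ) ^ (-s) * (z.2.2 : ℝ) ^ (-t) else 0) ≠ 0 →
      0 < z.1 ∧ Nat.Coprime z.2.1 z.2.2 := by
    intro z hz
    have h1 := left_ne_zero_of_mul hz
    have h2 := right_ne_zero_of_mul hz
    refine ⟨pos_of _ _ (by linarith) (right_ne_zero_of_mul h1), ?_⟩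
    by_contra hc
    rw [if_neg hc] at h2
    exact h2 rfl
  apply tsum_eq_tsum_of_ne_zero_bij (fun z => (z.1.1 * z.1.2.1, z.1.1 * z.1.2.2))
  · rintro ⟨⟨g, d, e⟩, hz⟩ ⟨⟨g', d', e'⟩, hz'⟩ h
    obtain ⟨hg, hc⟩ := supp _ hz
    obtain ⟨hg', hc'⟩ := supp _ hz'
    simp only [Prod.mk.injEq] at h hg hc hg' hc'
    obtain ⟨h1, h2⟩ := h
    have e1 : Nat.gcd (g * d) (g * e) = g := by rw [Nat.gcd_mul_left, hc.gcd_eq_one, mul_one]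
    have e2 : Nat.gcd (g' * d') (g' * e') = g' := by
      rw [Nat.gcd_mul_left, hc'.gcd_eq_one, mul_one]
    have e3 : g = g' := by rw [← e1, ← e2, h1, h2]
    subst e3
    have e4 := Nat.eq_of_mul_eq_mul_left hg h1
    have e5 := Nat.eq_of_mul_eq_mul_left hg h2
    subst e4 e5
    rfl
  · rintro ⟨d, e⟩ hde
    rw [Function.mem_support] at hde
    have h1 := left_ne_zero_of_mul hde
    have h2 := right_ne_zero_of_mul hde
    have hd := pos_of _ _ hs (left_ne_zero_of_mul h2)
    have he := pos_of _ _ ht (right_ne_zero_of_mul h2)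
    simp only at h1 hd he
    have hg : 0 < Nat.gcd d e := Nat.gcd_pos_of_pos_left _ hd
    have hg' : (0:ℝ) < Nat.gcd d e := by exact_mod_cast hg
    have dd := Nat.mul_div_cancel' (Nat.gcd_dvd_left d e)
    have ee := Nat.mul_div_cancel' (Nat.gcd_dvd_right d e)
    refine ⟨⟨(Nat.gcd d e, d / Nat.gcd d e, e / Nat.gcd d e), ?_⟩, ?_⟩
    · rw [Function.mem_support]
      simp only
      rw [if_pos (Nat.coprime_div_gcd_div_gcd hg)]
      have p1 : 0 < d / Nat.gcd d e := Nat.div_pos (Nat.gcd_le_left _ hd) hg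
      have p2 : 0 < e / Nat.gcd d e := Nat.div_pos (Nat.gcd_le_right _ he) hg
      have p1' : (0:ℝ) < (d / Nat.gcd d e : ℕ) := by exact_mod_cast p1
      have p2' : (0:ℝ) < (e / Nat.gcd d e : ℕ) := by exact_mod_cast p2
      apply mul_ne_zero (mul_ne_zero h1 (by positivity)) (by positivity)
    · simp only [dd, ee]
  · rintro ⟨⟨g, d, e⟩, hz⟩
    obtain ⟨hg, hc⟩ := supp _ hz
    simp only at hg hc ⊢
    rw [if_pos hc, Nat.gcd_mul_left, hc.gcd_eq_one, mul_one]
    have hg' : (0:ℝ) < g := by exact_mod_cast hg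
    push_cast
    rw [Real.mul_rpow hg'.le (by positivity), Real.mul_rpow hg'.le (by positivity), neg_add,
      Real.rpow_add hg']
    ring

lemma PP_eq {s t : ℝ} (hs : 1 < s) (ht : 1 < t) :
    PP s t = zetaR s * zetaR t / zetaR (s + t) := by
  have h := pair_identity hs ht (fun _ => 1) 1 (fun _ => zero_le_one) (fun _ => le_rfl)
  simp only [one_mul] at h
  rw [← zetaR_eq (by linarith), ← (zp_summable hs).tsum_mul_tsum (zp_summable ht)
    (pair_summable hs ht), ← zetaR_eq hs, ← zetaR_eq ht] at h
  have := zetaR_pos (s := s + t) (by linarith)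
  rw [h]
  field_simp

lemma ww_nonneg (n g : ℕ) : 0 ≤ ww n g := by unfold ww; split_ifs <;> positivity

lemma ww_le (n g : ℕ) : ww n g ≤ g := by
  unfold ww; split_ifs
  · exact le_rfl
  · positivity

lemma ww_le' (n g : ℕ) (hn : 0 < n) : ww n g ≤ n := by
  unfold ww; split_ifs with h
  · exact_mod_cast Nat.le_of_dvd hn h
  · positivity

lemma sigma_full (c : ℝ) (n : ℕ) (hn : 0 < n) :
    (n : ℝ) ^ c * ∑' g : ℕ, ww n g * (g : ℝ) ^ (-(c + 1)) = sigmaR c n := by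
  rw [tsum_eq_sum (s := n.divisors)]
  · unfold sigmaR
    rw [← Nat.sum_div_divisors n (fun d => (d : ℝ) ^ c), Finset.mul_sum]
    apply Finset.sum_congr rfl
    intro g hg
    have hgn := Nat.dvd_of_mem_divisors hg
    have hg' : (0:ℝ) < g := by exact_mod_cast Nat.pos_of_mem_divisors hg
    rw [ww, if_pos hgn, Nat.cast_div hgn hg'.ne', Real.div_rpow (by positivity) hg'.le, neg_add,
      Real.rpow_add hg', Real.rpow_neg hg'.le, Real.rpow_neg hg'.le, Real.rpow_one]
    field_simp
  · intro g hg
    rw [ww, if_neg, zero_mul]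
    intro h
    have hn0 : n ≠ 0 := by omega
    exact hg (Nat.mem_divisors.2 ⟨h, hn0⟩)

/-- tail function -/
noncomputable def uu (n : ℕ) (s : ℝ) (d : ℕ) : ℝ := if n ≤ d then (d : ℝ) ^ (-s) else 0

/-- truncated-weight function -/
noncomputable def vv (n : ℕ) (a : ℝ) (d : ℕ) : ℝ :=
  (if d ∈ Ico 1 n then (d : ℝ) ^ (-a) else 0) + n * uu n (a + 1) d

lemma uu_nonneg (n : ℕ) (s : ℝ) (d : ℕ) : 0 ≤ uu n s d := by
  unfold uu; split_ifs <;> positivity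

lemma vv_nonneg (n : ℕ) (s : ℝ) (d : ℕ) : 0 ≤ vv n s d := by
  unfold vv
  have := uu_nonneg n (s + 1) d
  split_ifs <;> positivity

lemma uu_summable (n : ℕ) {s : ℝ} (hs : 1 < s) : Summable (uu n s) := by
  apply Summable.of_nonneg_of_le (uu_nonneg n s) _ (zp_summable hs)
  intro d; unfold uu; split_ifs
  · exact le_rfl
  · positivity

lemma vv_hasSum (n : ℕ) {a : ℝ} (ha : 0 < a) :
    HasSum (vv n a) (∑ d ∈ Ico 1 n, (d : ℝ) ^ (-a) + n * ∑' d, uu n (a + 1) d) := by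
  unfold vv
  apply HasSum.add
  · have := hasSum_sum_of_ne_finset_zero (s := Ico 1 n)
      (f := fun d : ℕ => if d ∈ Ico 1 n then (d : ℝ) ^ (-a) else 0) (L := .unconditional ℕ)
      (fun d hd => if_neg hd)
    convert this using 1
    exact Finset.sum_congr rfl (fun d hd => (if_pos hd).symm)
  · exact (uu_summable n (by linarith)).hasSum.mul_left _

lemma step_ineq {a : ℝ} (ha : 0 < a) (d : ℕ) (hd : 2 ≤ d) :
    a * (d : ℝ) ^ (-(a + 1)) ≤ ((d : ℝ) - 1) ^ (-a) - (d : ℝ) ^ (-a) := by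
  have hd2 : (2:ℝ) ≤ d := by exact_mod_cast hd
  have hd0 : (0:ℝ) < d := by linarith
  set x : ℝ := 1 - 1 / d with hx
  have hx0 : 0 < x := by
    rw [hx, sub_pos, div_lt_one hd0]; linarith
  have e1 : (d : ℝ) - 1 = d * x := by rw [hx]; field_simp
  have h1 : 1 + a / d ≤ x ^ (-a) := by
    rw [Real.rpow_def_of_pos hx0]
    have h2 := Real.add_one_le_exp (Real.log x * -a)
    have h3 := Real.log_le_sub_one_of_pos hx0
    have h4 : Real.log x * a ≤ (x - 1) * a := by gcongr
    have h5 : (x - 1) * a = - (a / d) := by rw [hx]; field_simp; ring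
    linarith
  rw [e1, Real.mul_rpow hd0.le hx0.le, neg_add, Real.rpow_add hd0, Real.rpow_neg_one]
  have hp : 0 < (d : ℝ) ^ (-a) := by positivity
  have := mul_le_mul_of_nonneg_left h1 hp.le
  have e2 : (d : ℝ) ^ (-a) * (1 + a / d) = (d : ℝ) ^ (-a) + a * ((d : ℝ) ^ (-a) * (d : ℝ)⁻¹) := by
    field_simp
  linarith

lemma uu_tsum_le {a : ℝ} (ha : 0 < a) (n : ℕ) (hn : 2 ≤ n) :
    ∑' d, uu n (a + 1) d ≤ 2 ^ a / a * (n : ℝ) ^ (-a) := by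
  have hn2 : (2:ℝ) ≤ n := by exact_mod_cast hn
  have main : ∀ m : ℕ, a * ∑ d ∈ range (n + m), uu n (a + 1) d ≤
      ((n : ℝ) - 1) ^ (-a) - ((n : ℝ) + m - 1) ^ (-a) := by
    intro m
    induction m with
    | zero =>
      rw [Finset.sum_eq_zero]
      · simp
      · intro d hd
        rw [mem_range] at hd
        exact if_neg (by omega)
    | succ m ih =>
      rw [← add_assoc, Finset.sum_range_succ, mul_add]
      have h1 := step_ineq ha (n + m) (by omega)
      have h2 : uu n (a + 1) (n + m) = ((n + m : ℕ) : ℝ) ^ (-(a + 1)) := if_pos (by omega)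
      rw [h2]
      push_cast at h1 ⊢
      have e : (n : ℝ) + (m + 1) - 1 = n + m := by ring
      rw [e]
      linarith
  have h2 : ((n : ℝ) - 1) ^ (-a) ≤ 2 ^ a * (n : ℝ) ^ (-a) := by
    have e : (2 : ℝ) ^ a * (n : ℝ) ^ (-a) = ((n : ℝ) / 2) ^ (-a) := by
      rw [Real.div_rpow (by positivity) (by positivity), Real.rpow_neg (x := 2) (by positivity)]
      field_simp
    rw [e]
    apply Real.rpow_le_rpow_of_nonpos (by positivity) (by linarith) (by linarith)
  apply Real.tsum_le_of_sum_range_le (uu_nonneg n _)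
  intro m
  have h3 : ∑ d ∈ range m, uu n (a + 1) d ≤ ∑ d ∈ range (n + m), uu n (a + 1) d :=
    Finset.sum_le_sum_of_subset_of_nonneg (by
      intro x hx; rw [mem_range] at *; omega) (fun i _ _ => uu_nonneg _ _ _)
  refine h3.trans ?_
  rw [div_mul_eq_mul_div, le_div_iff₀ ha, mul_comm]
  have h4 : 0 ≤ ((n : ℝ) + m - 1) ^ (-a) := by
    apply Real.rpow_nonneg
    have : (0:ℝ) ≤ m := by positivity
    linarith
  linarith [main m]

lemma harm_le (n : ℕ) : ∑ d ∈ Ico 1 n, (d : ℝ) ^ (-1 : ℝ) ≤ 1 + Real.log n := by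
  have h := harmonic_le_one_add_log n
  rw [harmonic_eq_sum_Icc] at h
  push_cast at h
  refine le_trans ?_ h
  simp only [Real.rpow_neg_one]
  apply Finset.sum_le_sum_of_subset_of_nonneg
  · intro x hx; rw [mem_Ico] at hx; rw [mem_Icc]; omega
  · intro i _ _; positivity

lemma sum_a_le {a : ℝ} (ha1 : a ≤ 1) (n : ℕ) :
    ∑ d ∈ Ico 1 n, (d : ℝ) ^ (-a) ≤ (n : ℝ) ^ (1 - a) * (1 + Real.log n) := by
  refine le_trans ?_ (mul_le_mul_of_nonneg_left (harm_le n) (by positivity))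
  rw [Finset.mul_sum]
  apply Finset.sum_le_sum
  intro d hd
  rw [mem_Ico] at hd
  have hd0 : (0:ℝ) < d := by exact_mod_cast hd.1
  have hdn : (d:ℝ) ≤ n := by exact_mod_cast hd.2.le
  have : (d : ℝ) ^ (-a) = (d : ℝ) ^ (1 - a) * (d : ℝ) ^ (-1 : ℝ) := by
    rw [← Real.rpow_add hd0]; congr 1; ring
  rw [this]
  gcongr

lemma sum_b_le {b : ℝ} (hb : 1 ≤ b) (n : ℕ) :
    ∑ d ∈ Ico 1 n, (d : ℝ) ^ (-b) ≤ 1 + Real.log n := by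
  refine le_trans ?_ (harm_le n)
  apply Finset.sum_le_sum
  intro d hd
  rw [mem_Ico] at hd
  have hd1 : (1:ℝ) ≤ d := by exact_mod_cast hd.1
  exact Real.rpow_le_rpow_of_exponent_le hd1 (by linarith)

lemma ww_vv {a : ℝ} (ha : 0 < a) (n g d : ℕ) (hn : 0 < n) (hg : d ≠ 0 → g ≤ d) :
    ww n g * (d : ℝ) ^ (-(a + 1)) ≤ vv n a d := by
  rcases Nat.eq_zero_or_pos d with h | h
  · rw [h, Nat.cast_zero, Real.zero_rpow (by linarith), mul_zero]
    exact vv_nonneg _ _ _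
  have hd : (0:ℝ) < d := by exact_mod_cast h
  have hgd := hg h.ne'
  unfold vv uu
  by_cases hdn : n ≤ d
  · rw [if_pos hdn, if_neg (by rw [mem_Ico]; omega), zero_add]
    have := ww_le' n g hn
    gcongr
  · rw [if_neg hdn, if_pos (by rw [mem_Ico]; omega), mul_zero, add_zero]
    have e : (d : ℝ) ^ (-a) = d * (d : ℝ) ^ (-(a + 1)) := by
      rw [neg_add, Real.rpow_add hd, Real.rpow_neg_one]; field_simp
    rw [e]
    have h1 := ww_le n g
    have h2 : (g : ℝ) ≤ d := by exact_mod_cast hgd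
    gcongr
    linarith

/-- the full summand -/
noncomputable def FF (a b : ℝ) (n : ℕ) (p : ℕ × ℕ) : ℝ :=
  ww n (Nat.gcd p.1 p.2) * ((p.1 : ℝ) ^ (-(a + 1)) * (p.2 : ℝ) ^ (-(b + 1)))

lemma FF_nonneg (a b : ℝ) (n : ℕ) (p : ℕ × ℕ) : 0 ≤ FF a b n p := by
  unfold FF; have := ww_nonneg n (Nat.gcd p.1 p.2); positivity

lemma FF_summable {a b : ℝ} (ha : 0 < a) (hb : 0 < b) (n : ℕ) (hn : 0 < n) :
    Summable (FF a b n) := by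
  apply Summable.of_nonneg_of_le (FF_nonneg a b n) _
    ((pair_summable (s := a + 1) (t := b + 1) (by linarith) (by linarith)).mul_left (n : ℝ))
  intro p
  have := ww_le' n (Nat.gcd p.1 p.2) hn
  unfold FF
  gcongr

lemma FF_tail {a b : ℝ} (ha : 0 < a) (hb : 0 < b) (n : ℕ) (hn : 0 < n) :
    |∑ d ∈ Ico 1 n, ∑ e ∈ Ico 1 n, FF a b n (d, e) - ∑' p, FF a b n p| ≤
      (∑' d, uu n (a + 1) d) * (∑' e, vv n b e) + (∑' d, vv n a d) * (∑' e, uu n (b + 1) e) := by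
  have su := uu_summable n (s := a + 1) (by linarith)
  have su' := uu_summable n (s := b + 1) (by linarith)
  have sv := (vv_hasSum n ha).summable
  have sv' := (vv_hasSum n hb).summable
  have s1 := su.mul_of_nonneg sv' (uu_nonneg _ _) (vv_nonneg _ _)
  have s2 := sv.mul_of_nonneg su' (vv_nonneg _ _) (uu_nonneg _ _)
  rw [su.tsum_mul_tsum sv' s1, sv.tsum_mul_tsum su' s2, ← s1.tsum_add s2, ← Finset.sum_product']
  have hF := FF_summable ha hb n hn
  set Q := Ico 1 n ×ˢ Ico 1 n with hQ
  have hfin : HasSum (fun p => if p ∈ Q then FF a b n p else 0) (∑ p ∈ Q, FF a b n p) := by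
    have := hasSum_sum_of_ne_finset_zero (s := Q)
      (f := fun p => if p ∈ Q then FF a b n p else 0) (L := .unconditional (ℕ × ℕ))
      (fun d hd => if_neg hd)
    convert this using 1
    exact Finset.sum_congr rfl (fun d hd => (if_pos hd).symm)
  have hle : ∑ p ∈ Q, FF a b n p ≤ ∑' p, FF a b n p :=
    hF.sum_le_tsum Q (fun p _ => FF_nonneg _ _ _ _)
  have e1 : (∑ x ∈ Q, FF a b n (x.1, x.2)) = ∑ p ∈ Q, FF a b n p := rfl
  rw [e1, abs_sub_comm, abs_of_nonneg (by linarith), ← hfin.tsum_eq,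
    ← hF.tsum_sub hfin.summable]
  apply (hF.sub hfin.summable).tsum_le_tsum _ (s1.add s2)
  rintro ⟨d, e⟩
  simp only
  have n1 := mul_nonneg (uu_nonneg n (a + 1) d) (vv_nonneg n b e)
  have n2 := mul_nonneg (vv_nonneg n a d) (uu_nonneg n (b + 1) e)
  by_cases hp : (d, e) ∈ Q
  · rw [if_pos hp, sub_self]; linarith
  rw [if_neg hp, sub_zero]
  rcases Nat.eq_zero_or_pos d with h0 | h0
  · have : FF a b n (d, e) = 0 := by
      unfold FF; simp only [h0, Nat.cast_zero]
      rw [Real.zero_rpow (by linarith)]; simp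
    rw [this]; linarith
  rcases Nat.eq_zero_or_pos e with h0' | h0'
  · have : FF a b n (d, e) = 0 := by
      unfold FF; simp only [h0', Nat.cast_zero]
      rw [Real.zero_rpow (by linarith : -(b + 1) ≠ 0)]; simp
    rw [this]; linarith
  by_cases hd : n ≤ d
  · have k := ww_vv hb n (Nat.gcd d e) e hn (fun _ => Nat.gcd_le_right _ h0')
    have : FF a b n (d, e) ≤ uu n (a + 1) d * vv n b e := by
      have e1 : uu n (a + 1) d = (d : ℝ) ^ (-(a + 1)) := if_pos hd
      rw [e1]
      unfold FF
      have := mul_le_mul_of_nonneg_left k (show 0 ≤ (d : ℝ) ^ (-(a + 1)) by positivity)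
      simp only
      linarith
    linarith
  · have he : n ≤ e := by
      by_contra hc
      apply hp
      rw [hQ, mem_product, mem_Ico, mem_Ico]
      simp only
      omega
    have k := ww_vv ha n (Nat.gcd d e) d hn (fun _ => Nat.gcd_le_left _ h0)
    have : FF a b n (d, e) ≤ vv n a d * uu n (b + 1) e := by
      have e1 : uu n (b + 1) e = (e : ℝ) ^ (-(b + 1)) := if_pos he
      rw [e1]
      unfold FF
      have := mul_le_mul_of_nonneg_right k (show 0 ≤ (e : ℝ) ^ (-(b + 1)) by positivity)
      simp only
      linarith
    linarith

lemma FF_tail' {a b : ℝ} (ha : 0 < a) (ha1 : a ≤ 1) (hb : 1 ≤ b) (n : ℕ) (hn : 2 ≤ n) :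
    |∑ d ∈ Ico 1 n, ∑ e ∈ Ico 1 n, FF a b n (d, e) - ∑' p, FF a b n p| ≤
      (n : ℝ) ^ (-a) * ((2 ^ a / a + 2 * (2 ^ a / a) * (2 ^ b / b) + 2 ^ b / b)
        * (1 + Real.log n) ^ 2) := by
  have hb0 : 0 < b := by linarith
  refine (FF_tail ha hb0 n (by omega)).trans ?_
  rw [(vv_hasSum n ha).tsum_eq, (vv_hasSum n hb0).tsum_eq]
  have u1 := uu_tsum_le ha n hn
  have u2 := uu_tsum_le hb0 n hn
  have a1 := sum_a_le ha1 n
  have b1 := sum_b_le hb n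
  have hn1 : (1:ℝ) ≤ n := by exact_mod_cast (by omega : 1 ≤ n)
  have hn0 : (0:ℝ) < n := by linarith
  have hl : 1 ≤ 1 + Real.log n := by have := Real.log_nonneg hn1; linarith
  set l := 1 + Real.log n with hldef
  set A := (2:ℝ) ^ a / a with hA
  set B := (2:ℝ) ^ b / b with hB
  have hA0 : 0 < A := by positivity
  have hB0 : 0 < B := by positivity
  have U0 : 0 ≤ ∑' d, uu n (a + 1) d := tsum_nonneg (uu_nonneg _ _)
  have U0' : 0 ≤ ∑' d, uu n (b + 1) d := tsum_nonneg (uu_nonneg _ _)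
  have hx : (n : ℝ) * (n : ℝ) ^ (-b) ≤ 1 := by
    have : (n : ℝ) * (n : ℝ) ^ (-b) = (n : ℝ) ^ (1 - b) := by
      rw [sub_eq_add_neg, Real.rpow_add hn0, Real.rpow_one]
    rw [this]
    exact Real.rpow_le_one_of_one_le_of_nonpos hn1 (by linarith)
  have hy : (n : ℝ) ^ (1 - a) = n * (n : ℝ) ^ (-a) := by
    rw [sub_eq_add_neg, Real.rpow_add hn0, Real.rpow_one]
  rw [hy] at a1
  set X := (n : ℝ) ^ (-a) with hX
  set Y := (n : ℝ) ^ (-b) with hY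
  have hX0 : 0 < X := by positivity
  have hY0 : 0 < Y := by positivity
  calc _ ≤ (A * X) * (l + n * (B * Y)) + (n * X * l + n * (A * X)) * (B * Y) := by
        have S0 : 0 ≤ ∑ d ∈ Ico 1 n, (d : ℝ) ^ (-b) := Finset.sum_nonneg (fun _ _ => by positivity)
        gcongr
    _ = X * (A * (l + B * (n * Y)) + (l + A) * B * (n * Y)) := by ring
    _ ≤ X * (A * (l + B * 1) + (l + A) * B * 1) := by gcongr
    _ = X * (A * l + 2 * A * B + B * l) := by ring
    _ ≤ X * (A * l ^ 2 + 2 * A * B * l ^ 2 + B * l ^ 2) := by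
        have h1 : l ≤ l ^ 2 := by nlinarith
        have h2 : 1 ≤ l ^ 2 := by nlinarith
        have h3 : 2 * A * B * 1 ≤ 2 * A * B * l ^ 2 := by gcongr
        rw [mul_one] at h3
        gcongr
    _ = _ := by ring

theorem stmt16 (a b : ℝ) (ha : 0 < a) (ha1 : a ≤ 1) (hb : 1 ≤ b) :
    ∃ C : ℝ, ∀ n : ℕ, 2 ≤ n →
      |SR a b n
        - (Real.Gamma (a + 1) * Real.Gamma (b + 1) / Real.Gamma (a + b + 2))
            * (zetaR (a + 1) * zetaR (b + 1) / zetaR (a + b + 2)) * sigmaR (a + b + 1) n|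
      ≤ C * (n : ℝ) ^ (b + 1) * (Real.log n) ^ 2 := by
  have hb0 : 0 < b := by linarith
  set β := Real.Gamma (a + 1) * Real.Gamma (b + 1) / Real.Gamma (a + b + 2) with hβ
  have hβ0 : 0 < β := by
    have h1 := Real.Gamma_pos_of_pos (show 0 < a + 1 by linarith)
    have h2 := Real.Gamma_pos_of_pos (show 0 < b + 1 by linarith)
    have h3 := Real.Gamma_pos_of_pos (show 0 < a + b + 2 by linarith)
    positivity
  set D := (2:ℝ) ^ a / a + 2 * (2 ^ a / a) * (2 ^ b / b) + 2 ^ b / b with hD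
  have hD0 : 0 < D := by positivity
  refine ⟨(3 + β * D) * 9, ?_⟩
  intro n hn
  have hn2 : (2:ℝ) ≤ n := by exact_mod_cast hn
  have hn0 : (0:ℝ) < n := by linarith
  have hlog : 1 / 2 ≤ Real.log n := by
    have h1 : Real.log 2 ≤ Real.log n := Real.log_le_log (by norm_num) hn2
    have h2 := Real.log_two_gt_d9
    linarith
  have hl : 1 + Real.log n ≤ 3 * Real.log n := by linarith
  have hl0 : 0 ≤ 1 + Real.log n := by linarith
  -- the main term
  have hmain : β * (zetaR (a + 1) * zetaR (b + 1) / zetaR (a + b + 2)) * sigmaR (a + b + 1) n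
      = (n : ℝ) ^ (a + b + 1) * β * ∑' p, FF a b n p := by
    have h1 := pair_identity (s := a + 1) (t := b + 1) (by linarith) (by linarith) (ww n) n
      (ww_nonneg n) (fun g => ww_le' n g (by omega))
    have e1 : a + 1 + (b + 1) = a + b + 2 := by ring
    have e2 : a + b + 1 + 1 = a + b + 2 := by ring
    rw [PP_eq (by linarith) (by linarith), e1] at h1
    have h2 := sigma_full (a + b + 1) n (by omega)
    rw [e2] at h2
    unfold FF
    rw [h1, ← h2]
    ring
  have hS : SR a b n - (n : ℝ) ^ (a + b + 1) * β * ∑ d ∈ Ico 1 n, ∑ e ∈ Ico 1 n, FF a b n (d, e)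
      = ∑ d ∈ Ico 1 n, ∑ e ∈ Ico 1 n, (d : ℝ) ^ (-a) * (e : ℝ) ^ (-b) *
        (TT a b n d e - (n : ℝ) ^ (a + b + 1) * β * (ww n (Nat.gcd d e) / (d * e))) := by
    rw [SR_eq, Finset.mul_sum, ← Finset.sum_sub_distrib]
    apply Finset.sum_congr rfl
    intro d hd
    rw [Finset.mul_sum, ← Finset.sum_sub_distrib]
    apply Finset.sum_congr rfl
    intro e he
    rw [mem_Ico] at hd he
    have hd0 : (0:ℝ) < d := by exact_mod_cast hd.1
    have he0 : (0:ℝ) < e := by exact_mod_cast he.1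
    unfold FF
    simp only
    rw [neg_add, Real.rpow_add hd0, neg_add, Real.rpow_add he0, Real.rpow_neg_one,
      Real.rpow_neg_one]
    field_simp
  have hE1 : |SR a b n - (n : ℝ) ^ (a + b + 1) * β *
      ∑ d ∈ Ico 1 n, ∑ e ∈ Ico 1 n, FF a b n (d, e)|
      ≤ 3 * (n : ℝ) ^ (b + 1) * (1 + Real.log n) ^ 2 := by
    rw [hS]
    calc _ ≤ ∑ d ∈ Ico 1 n, ∑ e ∈ Ico 1 n, (d : ℝ) ^ (-a) * (e : ℝ) ^ (-b) *
          (3 * (n : ℝ) ^ (a + b)) := by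
          refine (Finset.abs_sum_le_sum_abs _ _).trans (Finset.sum_le_sum fun d hd => ?_)
          refine (Finset.abs_sum_le_sum_abs _ _).trans (Finset.sum_le_sum fun e he => ?_)
          rw [mem_Ico] at hd he
          rw [abs_mul, abs_of_nonneg (by positivity : 0 ≤ (d : ℝ) ^ (-a) * (e : ℝ) ^ (-b))]
          have := TT_bound ha hb0 n d e (by omega) (by omega) (by omega)
          gcongr
      _ = (∑ d ∈ Ico 1 n, (d : ℝ) ^ (-a)) * (∑ e ∈ Ico 1 n, (e : ℝ) ^ (-b)) *
          (3 * (n : ℝ) ^ (a + b)) := by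
          rw [Finset.sum_mul_sum, Finset.sum_mul]
          simp only [Finset.sum_mul]
      _ ≤ ((n : ℝ) ^ (1 - a) * (1 + Real.log n)) * (1 + Real.log n) *
          (3 * (n : ℝ) ^ (a + b)) := by
          have h1 := sum_a_le ha1 n
          have h2 := sum_b_le hb n
          have S0 : 0 ≤ ∑ d ∈ Ico 1 n, (d : ℝ) ^ (-b) :=
            Finset.sum_nonneg (fun _ _ => by positivity)
          gcongr
      _ = 3 * ((n : ℝ) ^ (1 - a) * (n : ℝ) ^ (a + b)) * (1 + Real.log n) ^ 2 := by ring
      _ = _ := by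
          rw [← Real.rpow_add hn0]
          congr 3
          ring
  have hE2 : |(n : ℝ) ^ (a + b + 1) * β * ∑ d ∈ Ico 1 n, ∑ e ∈ Ico 1 n, FF a b n (d, e)
      - (n : ℝ) ^ (a + b + 1) * β * ∑' p, FF a b n p|
      ≤ β * D * (n : ℝ) ^ (b + 1) * (1 + Real.log n) ^ 2 := by
    rw [← mul_sub, abs_mul, abs_of_nonneg (by positivity : 0 ≤ (n : ℝ) ^ (a + b + 1) * β)]
    calc _ ≤ (n : ℝ) ^ (a + b + 1) * β * ((n : ℝ) ^ (-a) * (D * (1 + Real.log n) ^ 2)) := by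
          have := FF_tail' ha ha1 hb n hn
          gcongr
      _ = β * D * ((n : ℝ) ^ (a + b + 1) * (n : ℝ) ^ (-a)) * (1 + Real.log n) ^ 2 := by ring
      _ = _ := by
          rw [← Real.rpow_add hn0]
          congr 3
          ring
  rw [hmain]
  calc _ ≤ _ := abs_sub_le _ _ _
    _ ≤ _ := add_le_add hE1 hE2
    _ = (3 + β * D) * (n : ℝ) ^ (b + 1) * (1 + Real.log n) ^ 2 := by ring
    _ ≤ (3 + β * D) * (n : ℝ) ^ (b + 1) * (3 * Real.log n) ^ 2 := by gcongr
    _ = _ := by ring
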